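/- Let β be a cycle on a state q of a d-TVASS, and assume that the linear path scheme β* is bounded from a configuration q(x⃗). Then every configuration q(y⃗) such that q(x⃗) →^{βⁿ} q(y⃗) for some n ≥ 2 satisfies ‖y⃗‖ ≤ (1 + ‖Δ(β)‖)·‖x⃗‖, where ‖Δ(β)‖ is the maximum absolute value of a component of Δ(β). -/

import Mathlib

namespace TVASSpaper

/-- Actions of a `d`-TVASS: `some a` is an addition of the vector `a ∈ ℤ^d`,
    `none` is the zero-test action `tst` (on the first counter). -/
abbrev Act (d : ℕ) := Option (Fin d → ℤ)

/-- Transitions. -/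
abbrev Trans (d : ℕ) (Q : Type) := Q × Act d × Q

/-- Configurations: a state together with a vector of `d` counters. -/
abbrev Config (d : ℕ) (Q : Type) := Q × (Fin d → ℕ)

/-- A `d`-TVASS: a finite set `acts` of actions and a finite set of transitions
    `trans ⊆ Q × acts × Q`. The state set `Q` is a (finite, nonempty) type. -/
structure TVASS (d : ℕ) (Q : Type) where
  acts : Finset (Act d)
  trans : Finset (Trans d Q)
  mem_acts : ∀ t ∈ trans, t.2.1 ∈ acts

variable {d : ℕ} {Q : Type}

/-- The step induced by a single transition: an addition transition `(p, a, q)`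
    induces `p(x) → q(x + a)` whenever `x + a ∈ ℕ^d`; a zero-test transition
    `(p, tst, q)` induces `p(x) → q(x)` whenever the first counter is `0`. -/
def StepBy [NeZero d] (t : Trans d Q) (c c' : Config d Q) : Prop :=
  t.1 = c.1 ∧ t.2.2 = c'.1 ∧
    match t.2.1 with
    | some a => ∀ i, (c'.2 i : ℤ) = (c.2 i : ℤ) + a i
    | none => c.2 0 = 0 ∧ c'.2 = c.2

/-- `Run V c π c'` : there is a run from `c` to `c'` taking the steps of the
    word of transitions `π` in order. -/
inductive Run [NeZero d] (V : TVASS d Q) :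
    Config d Q → List (Trans d Q) → Config d Q → Prop
  | nil (c : Config d Q) : Run V c [] c
  | cons {t : Trans d Q} {c c' c'' : Config d Q} {π : List (Trans d Q)} :
      t ∈ V.trans → StepBy t c c' → Run V c' π c'' → Run V c (t :: π) c''

/-- One step of the TVASS. -/
def Step [NeZero d] (V : TVASS d Q) (c c' : Config d Q) : Prop :=
  ∃ t ∈ V.trans, StepBy t c c'

/-- Reachability `c →* c'`. -/
def Reach [NeZero d] (V : TVASS d Q) (c c' : Config d Q) : Prop :=
  ∃ π, Run V c π c'

/-- `IsPathFrom V p π q` : `π` is a path (word of transitions of `V` with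
    matching endpoints) from state `p` to state `q`. -/
inductive IsPathFrom (V : TVASS d Q) : Q → List (Trans d Q) → Q → Prop
  | nil (p : Q) : IsPathFrom V p [] p
  | cons {t : Trans d Q} {π : List (Trans d Q)} {q : Q} :
      t ∈ V.trans → IsPathFrom V t.2.2 π q → IsPathFrom V t.1 (t :: π) q

/-- `n`-fold concatenation of a word. -/
def pw {α : Type*} (l : List α) (n : ℕ) : List α := (List.replicate n l).flatten

/-- A linear path scheme `α₀ β₁* α₁ ⋯ β_k* α_k`, given by the head path `α₀`
    and the list of pairs `(β₁, α₁), …, (β_k, α_k)`. -/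
structure LPS (d : ℕ) (Q : Type) where
  head : List (Trans d Q)
  rest : List (List (Trans d Q) × List (Trans d Q))

/-- Length `|L|` of a linear path scheme. -/
def LPS.len (L : LPS d Q) : ℕ :=
  L.head.length + (L.rest.map fun p => p.1.length + p.2.length).sum

/-- Number of stars `|L|_*` of a linear path scheme. -/
def LPS.stars (L : LPS d Q) : ℕ := L.rest.length

def wordRest : List (List (Trans d Q) × List (Trans d Q)) → List ℕ → List (Trans d Q)
  | [], _ => []
  | p :: rest, ns => pw p.1 (ns.headD 0) ++ p.2 ++ wordRest rest ns.tail

/-- The word `α₀ β₁^{n₁} α₁ ⋯ β_k^{n_k} α_k` of `L` for exponents `ns`. -/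
def LPS.word (L : LPS d Q) (ns : List ℕ) : List (Trans d Q) :=
  L.head ++ wordRest L.rest ns

/-- Well-formedness of the tail of a linear path scheme starting in state `s`:
    the `βᵢ` are cycles and the `αᵢ` are paths, with matching endpoints. -/
inductive ChainLPS (V : TVASS d Q) :
    Q → List (List (Trans d Q) × List (Trans d Q)) → Q → Prop
  | nil (q : Q) : ChainLPS V q [] q
  | cons {s s' q : Q} {β α : List (Trans d Q)}
      {rest : List (List (Trans d Q) × List (Trans d Q))} :
      IsPathFrom V s β s → IsPathFrom V s α s' → ChainLPS V s' rest q →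
      ChainLPS V s ((β, α) :: rest) q

/-- `L` is a genuine linear path scheme from `p` to `q` in `V`. -/
def IsLPS (V : TVASS d Q) (p : Q) (L : LPS d Q) (q : Q) : Prop :=
  ∃ s, IsPathFrom V p L.head s ∧ ChainLPS V s L.rest q

/-- `c →^L c'` : reachability along the linear path scheme `L`. -/
def ReachLPS [NeZero d] (V : TVASS d Q) (L : LPS d Q) (c c' : Config d Q) : Prop :=
  ∃ ns, Run V c (L.word ns) c'

/-- `‖x⃗‖`: maximum component of a vector of naturals. -/
def vnorm {d : ℕ} (v : Fin d → ℕ) : ℕ := Finset.univ.sup v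

/-- Maximum absolute value of a component of an integer vector. -/
def vnormZ {d : ℕ} (v : Fin d → ℤ) : ℕ := Finset.univ.sup fun i => (v i).natAbs

/-- `‖Σ‖`: maximum absolute value of a component of a vector in `Σ ∖ {tst}`
    (0 if `Σ ⊆ {tst}`). -/
def TVASS.actNorm (V : TVASS d Q) : ℕ :=
  V.acts.sup fun a => a.elim 0 vnormZ

/-- Displacement of a word of transitions (zero-tests contribute `0`). -/
def disp (π : List (Trans d Q)) : Fin d → ℤ :=
  fun i => (π.map fun t => (t.2.1.elim 0 id : Fin d → ℤ) i).sum

/-- `m_π(i)`: max over prefixes `α` of `π` (including the empty prefix) of `-Δ(α)(i)`. -/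
def mpre (π : List (Trans d Q)) (i : Fin d) : ℤ :=
  (π.inits.map fun α => -(disp α i)).foldr max 0

/-- `m_π̄(i)`: max over suffixes `σ` of `π` (including the empty suffix) of `Δ(σ)(i)`. -/
def msuf (π : List (Trans d Q)) (i : Fin d) : ℤ :=
  (π.tails.map fun σ => disp σ i).foldr max 0

/-- `π` contains no zero-test transition. -/
def noTst (π : List (Trans d Q)) : Prop := ∀ t ∈ π, t.2.1 ≠ none

/-- `x⃗ ≥₁ m⃗` : `x⃗(1) = m⃗(1)` and `x⃗(i) ≥ m⃗(i)` for all other `i`. -/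
def ge1 [NeZero d] (x : Fin d → ℕ) (m : Fin d → ℤ) : Prop :=
  (x 0 : ℤ) = m 0 ∧ ∀ i : Fin d, i ≠ 0 → m i ≤ (x i : ℤ)

/-- A path from `p` to `q` is feasible if some run takes it. -/
def Feasible [NeZero d] (V : TVASS d Q) (p : Q) (π : List (Trans d Q)) (q : Q) : Prop :=
  ∃ x y, Run V (p, x) π (q, y)

/-- `c →^{A* ∪ T} c'` : there is a run from `c` to `c'` whose path either
    contains no zero-test transition, or is a single zero-test transition. -/
def ReachAT [NeZero d] (V : TVASS d Q) (c c' : Config d Q) : Prop :=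
  ∃ π, Run V c π c' ∧ (noTst π ∨ ∃ t : Trans d Q, π = [t] ∧ t.2.1 = none)

/-- `p ⇝ q` for a 2-TVASS: `p(0, x) →* q(0, y)` for some `x, y ∈ ℕ`. -/
def Leads (V : TVASS 2 Q) (p q : Q) : Prop :=
  ∃ x y : ℕ, Reach V (p, ![0, x]) (q, ![0, y])

/-- The linear path scheme `L` is bounded from the configuration `c`: the set of
    configurations reachable from `c` along a prefix of a path in `L` is finite. -/
def BoundedLPS [NeZero d] (V : TVASS d Q) (L : LPS d Q) (c : Config d Q) : Prop :=
  {c' : Config d Q | ∃ ns ρ, ρ <+: L.word ns ∧ Run V c ρ c'}.Finite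


theorem pw_succ {α : Type*} (l : List α) (n : ℕ) : pw l (n + 1) = l ++ pw l n := by
  simp [pw, List.replicate_succ]

theorem disp_cons (t : Trans d Q) (π : List (Trans d Q)) (i : Fin d) :
    disp (t :: π) i = (t.2.1.elim 0 id : Fin d → ℤ) i + disp π i := by
  simp [disp]

theorem disp_append (π ρ : List (Trans d Q)) (i : Fin d) :
    disp (π ++ ρ) i = disp π i + disp ρ i := by
  simp [disp]

theorem disp_pw (π : List (Trans d Q)) (n : ℕ) (i : Fin d) :
    disp (pw π n) i = n * disp π i := by
  induction n with
  | zero => simp [pw, disp]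
  | succ n ih =>
    rw [pw_succ, disp_append, ih]
    push_cast
    ring

theorem StepBy.counter_eq [NeZero d] {t : Trans d Q} {c c' : Config d Q} (h : StepBy t c c')
    (i : Fin d) : (c'.2 i : ℤ) = c.2 i + (t.2.1.elim 0 id : Fin d → ℤ) i := by
  obtain ⟨p, a, r⟩ := t
  obtain ⟨-, -, h⟩ := h
  cases a with
  | none => simp_all
  | some a => simpa using h i

theorem Run.append [NeZero d] {V : TVASS d Q} {c c' c'' : Config d Q}
    {π ρ : List (Trans d Q)} (h : Run V c π c') (h' : Run V c' ρ c'') :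
    Run V c (π ++ ρ) c'' := by
  induction h with
  | nil => exact h'
  | cons ht hs _ ih => exact .cons ht hs (ih h')

theorem Run.exists_of_append [NeZero d] {V : TVASS d Q} {π ρ : List (Trans d Q)}
    {c c'' : Config d Q} (h : Run V c (π ++ ρ) c'') :
    ∃ c', Run V c π c' ∧ Run V c' ρ c'' := by
  induction π generalizing c with
  | nil => exact ⟨c, .nil c, h⟩
  | cons t π ih =>
    cases h with
    | cons ht hs hr =>
      obtain ⟨c', h₁, h₂⟩ := ih hr
      exact ⟨c', .cons ht hs h₁, h₂⟩

theorem Run.counter_eq [NeZero d] {V : TVASS d Q} {c c' : Config d Q} {π : List (Trans d Q)}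
    (h : Run V c π c') (i : Fin d) : (c'.2 i : ℤ) = c.2 i + disp π i := by
  induction h with
  | nil => simp [disp]
  | cons _ hs _ ih =>
    rw [ih, hs.counter_eq, disp_cons]
    ring

theorem Run.target_eq [NeZero d] {V : TVASS d Q} {π : List (Trans d Q)} {p r : Q}
    (hπ : IsPathFrom V p π r) {c c' : Config d Q} (hc : c.1 = p) (h : Run V c π c') :
    c'.1 = r := by
  induction hπ generalizing c with
  | nil => cases h; exact hc
  | cons _ _ ih =>
    cases h with
    | cons _ hs hr => exact ih hs.2.1.symm hr

/-- Runs can be lifted by any vector that does not disturb their zero-tests. -/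
theorem Run.add [NeZero d] {V : TVASS d Q} {c c' : Config d Q} {π : List (Trans d Q)}
    (h : Run V c π c') (v : Fin d → ℕ) (hv : v 0 = 0 ∨ noTst π) :
    Run V (c.1, c.2 + v) π (c'.1, c'.2 + v) := by
  induction h with
  | nil => exact .nil _
  | @cons t c c' c'' π ht hs _ ih =>
    refine .cons ht ?_ (ih (hv.imp_right fun h s hsm => h s (List.mem_cons_of_mem _ hsm)))
    obtain ⟨p, a, r⟩ := t
    obtain ⟨h₁, h₂, h₃⟩ := hs
    refine ⟨h₁, h₂, ?_⟩
    cases a with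
    | none =>
      have hv : v 0 = 0 := hv.resolve_right fun h => h _ List.mem_cons_self rfl
      exact ⟨by simp [h₃.1, hv], by simp [h₃.2]⟩
    | some a =>
      intro i
      have := h₃ i
      simp only [Pi.add_apply, Nat.cast_add]
      linarith

/-- Along a path with a zero-test, the first counter of a run is determined by the path. -/
theorem Run.counter_zero_eq [NeZero d] {V : TVASS d Q} {π : List (Trans d Q)}
    (hπ : ¬ noTst π) {c₁ c₁' c₂ c₂' : Config d Q} (h₁ : Run V c₁ π c₁')
    (h₂ : Run V c₂ π c₂') : c₁.2 0 = c₂.2 0 := by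
  induction h₁ generalizing c₂ with
  | nil => simp [noTst] at hπ
  | @cons t c c' c'' π ht hs _ ih =>
    cases h₂ with
    | cons _ hs' hr' =>
      by_cases ha : t.2.1 = none
      · obtain ⟨p, a, r⟩ := t
        obtain rfl : a = none := ha
        exact hs.2.2.1.trans hs'.2.2.1.symm
      · have := ih (fun h => hπ (by simpa [noTst, ha] using h)) hr'
        have e₁ := hs.counter_eq 0
        have e₂ := hs'.counter_eq 0
        lia

/-- A cycle with nonnegative nonzero displacement that can be taken twice is unbounded. -/
theorem exists_disp_neg_of_bounded [NeZero d] {V : TVASS d Q} {q : Q} {β : List (Trans d Q)}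
    (hcyc : IsPathFrom V q β q) {x : Fin d → ℕ}
    (hbdd : BoundedLPS V ⟨[], [(β, [])]⟩ (q, x)) {c c' : Config d Q}
    (h₁ : Run V (q, x) β c) (h₂ : Run V c β c') (hne : disp β ≠ 0) :
    ∃ i, disp β i < 0 := by
  by_contra! hpos
  obtain ⟨r, z⟩ := c
  obtain rfl : r = q := h₁.target_eq hcyc rfl
  set v : Fin d → ℕ := fun i => (disp β i).toNat with hv
  have hvi (i : Fin d) : (v i : ℤ) = disp β i := Int.toNat_of_nonneg (hpos i)
  have hz : z = x + v := by
    funext i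
    have := h₁.counter_eq i
    have := hvi i
    simp only [Pi.add_apply] at *
    lia
  subst hz
  have hv0 : v 0 = 0 ∨ noTst β := by
    by_cases hβ : noTst β
    · exact .inr hβ
    · have := Run.counter_zero_eq hβ h₁ h₂
      simp only [Pi.add_apply] at this
      exact .inl (by lia)
  have hrun (k : ℕ) : Run V (r, x + k • v) β (r, x + (k + 1) • v) := by
    have := h₁.add (k • v) (hv0.imp_left fun h => by simp [h])
    convert this using 2
    rw [succ_nsmul, add_assoc, add_comm v]
  have hiter (n : ℕ) : ∀ k, Run V (r, x + k • v) (pw β n) (r, x + (k + n) • v) := by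
    induction n with
    | zero => exact fun k => .nil _
    | succ n ih =>
      intro k
      rw [pw_succ]
      have := ih (k + 1)
      rw [add_right_comm, add_assoc] at this
      exact (hrun k).append this
  refine Set.infinite_of_injective_forall_mem (f := fun n : ℕ => (r, x + n • v)) ?_ ?_ hbdd
  · obtain ⟨i, hi⟩ := Function.ne_iff.mp hne
    have hvi0 : v i ≠ 0 := fun h => hi (by rw [← hvi, h]; rfl)
    intro m n hmn
    have := congrFun (Prod.mk.inj hmn).2 i
    simpa [hvi0] using this
  · intro n
    refine ⟨[n], pw β n, by simp [LPS.word, wordRest], ?_⟩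
    simpa using hiter n 0

/-- Lemma: bounded iterated cycles do not blow up configurations. -/
theorem bounded_cycle_norm (d : ℕ) [NeZero d] (Q : Type) [Fintype Q] [Nonempty Q]
    (V : TVASS d Q) (q : Q) (β : List (Trans d Q))
    (hcyc : IsPathFrom V q β q) (x : Fin d → ℕ)
    (hbdd : BoundedLPS V ⟨[], [(β, [])]⟩ (q, x)) :
    ∀ (y : Fin d → ℕ) (n : ℕ), 2 ≤ n →
      Run V (q, x) (pw β n) (q, y) →
      vnorm y ≤ (1 + vnormZ (disp β)) * vnorm x := by
  intro y n hn hrun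
  have hy (i : Fin d) : (y i : ℤ) = x i + n * disp β i := by
    rw [← disp_pw]
    exact hrun.counter_eq i
  have hx (i : Fin d) : x i ≤ vnorm x := Finset.le_sup (f := x) (Finset.mem_univ i)
  have hΔ (i : Fin d) : disp β i ≤ vnormZ (disp β) := by
    have : (disp β i).natAbs ≤ vnormZ (disp β) :=
      Finset.le_sup (f := fun i => (disp β i).natAbs) (Finset.mem_univ i)
    lia
  refine Finset.sup_le fun i _ => ?_
  by_cases hne : disp β = 0
  · have := hy i
    simp only [hne, Pi.zero_apply, mul_zero, add_zero, Nat.cast_inj] at this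
    rw [this]
    exact (hx i).trans (Nat.le_mul_of_pos_left _ (by lia))
  · obtain ⟨n, rfl⟩ := Nat.exists_eq_add_of_le' hn
    have hrun' := hrun
    rw [pw_succ, pw_succ] at hrun'
    obtain ⟨c, h₁, hr⟩ := hrun'.exists_of_append
    obtain ⟨c', h₂, -⟩ := hr.exists_of_append
    obtain ⟨j, hj⟩ := exists_disp_neg_of_bounded hcyc hbdd h₁ h₂ hne
    have hn : ((n + 2 : ℕ) : ℤ) ≤ vnorm x := by
      have := hy j
      have := hx j
      nlinarith
    have := hy i
    have := hx i
    have h₃ : ((n + 2 : ℕ) : ℤ) * disp β i ≤ vnorm x * vnormZ (disp β) :=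
      (mul_le_mul_of_nonneg_left (hΔ i) (by positivity)).trans
        (mul_le_mul_of_nonneg_right hn (by positivity))
    zify
    linarith

end TVASSpaper
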